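/- arXiv:2211.02508 — 6 statements merged into one kernel-verified Lean document; each statement's English description precedes it below -/
import Mathlib

section
/- Let α > 0, h > 0, β ∈ ℝ with β ≠ 0, and Λ₀, Λ₁ ∈ ℝ. Set μ(x) = exp(−βx/α) for x ∈ [0,h]. Then the real number J := β·(Λ₀ − e^{−βh/α}·Λ₁)/(1 − e^{−βh/α}) is the unique real number satisfying J·∫₀^h μ(x) dx + α·(Λ₁·μ(h) − Λ₀·μ(0)) = 0, and moreover J = (α/h)·( B(−βh/α)·Λ₀ − B(βh/α)·Λ₁ ), where B is the Bernoulli function. In other words, the lowest-order (piecewise-constant, k = 0) local flux equation of the W-HDG scheme on a one-dimensional cell of length h produces exactly the Scharfetter–Gummel two-point flux. -/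
open MeasureTheory

theorem integral_exp_mul_left {c : ℝ} (hc : c ≠ 0) (a b : ℝ) :
    ∫ x in a..b, Real.exp (c * x) = (Real.exp (c * b) - Real.exp (c * a)) / c := by
  rw [intervalIntegral.integral_comp_mul_left (fun x => Real.exp x) hc, integral_exp,
    smul_eq_mul, inv_mul_eq_div]

/-- the lowest-order (k = 0) local W-HDG flux equation on a one-dimensional
cell of length `h` with exponential weight `μ(x) = exp(-βx/α)` is uniquely solved by the
Scharfetter–Gummel two-point flux. -/
theorem stmt6 (α h β Λ₀ Λ₁ : ℝ) (hα : 0 < α) (hh : 0 < h) (hβ : β ≠ 0)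
    (μ : ℝ → ℝ) (hμ : ∀ x, μ x = Real.exp (-β * x / α))
    (B : ℝ → ℝ) (hB : ∀ t, t ≠ 0 → B t = t / (Real.exp t - 1))
    (J : ℝ)
    (hJ : J = β * (Λ₀ - Real.exp (-β * h / α) * Λ₁) / (1 - Real.exp (-β * h / α))) :
    (J * (∫ x in (0:ℝ)..h, μ x) + α * (Λ₁ * μ h - Λ₀ * μ 0) = 0) ∧
    (∀ J' : ℝ, J' * (∫ x in (0:ℝ)..h, μ x) + α * (Λ₁ * μ h - Λ₀ * μ 0) = 0 → J' = J) ∧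
    (J = (α / h) * (B (-β * h / α) * Λ₀ - B (β * h / α) * Λ₁)) := by
  have hα' := hα.ne'
  have hh' := hh.ne'
  have ht : β * h / α ≠ 0 := by positivity
  have ht' : -β * h / α = -(β * h / α) := by ring
  have hint : ∫ x in (0:ℝ)..h, μ x = α / β * (1 - Real.exp (-β * h / α)) := by
    have hμ' : μ = fun x => Real.exp (-β / α * x) := by
      ext x
      rw [hμ, div_mul_eq_mul_div]
    rw [hμ', integral_exp_mul_left (div_ne_zero (neg_ne_zero.mpr hβ) hα'), div_mul_eq_mul_div,
      mul_zero, Real.exp_zero]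
    field_simp
    ring
  have hμ0 : μ 0 = 1 := by simp [hμ]
  have hinv : Real.exp (β * h / α) = (Real.exp (-β * h / α))⁻¹ := by
    rw [ht', Real.exp_neg, inv_inv]
  have he1 : Real.exp (-β * h / α) ≠ 1 := by
    rw [ht', Ne, Real.exp_eq_one_iff]
    exact neg_ne_zero.mpr ht
  have he0 := Real.exp_ne_zero (-β * h / α)
  rw [hB _ ht, hB _ (ht' ▸ neg_ne_zero.mpr ht), hint, hμ0, hμ h, hinv, hJ]
  generalize Real.exp (-β * h / α) = e at *
  have h1 : 1 - e ≠ 0 := sub_ne_zero.mpr he1.symm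
  have h3 : e⁻¹ - 1 = (1 - e) / e := by field_simp
  refine ⟨by field_simp; ring, fun J' hJ' => ?_, ?_⟩
  · field_simp at hJ' ⊢
    rw [mul_zero] at hJ'
    linear_combination (mul_eq_zero.mp hJ').resolve_left hα'
  · rw [h3, ← neg_sub 1 e]
    field_simp
end

section
/- Let α > 0, h > 0, β ∈ ℝ, τ > 0, Λ₀, Λ₁ ∈ ℝ, and let f : [0,h] → ℝ be integrable. Set μ(x) = exp(−β(x − h/2)/α), e₊ = exp(βh/(2α)), e₋ = exp(−βh/(2α)), and F = ∫₀^h f(x)·μ(x) dx. Then for every J ∈ ℝ, a real number U satisfies (β/α)·J·∫₀^h μ(x) dx + (J + τ(U − Λ₁))·μ(h) + (−J + τ(U − Λ₀))·μ(0) = F if and only if U = (e₊·Λ₀ + e₋·Λ₁)/(e₊ + e₋) + F/(τ·(e₊ + e₋)). -/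
open MeasureTheory

/-- The exponential weight `μ` satisfies `μ' = -(β / α) μ`, in integrated form. -/
theorem integral_exp_weight (α β c a b : ℝ) :
    (β / α) * (∫ x in a..b, Real.exp (-β * (x - c) / α))
      = Real.exp (-β * (a - c) / α) - Real.exp (-β * (b - c) / α) := by
  have hderiv : ∀ x ∈ Set.uIcc a b, HasDerivAt (fun x => -Real.exp (-β * (x - c) / α))
      ((β / α) * Real.exp (-β * (x - c) / α)) x := by
    intro x _
    have hlin : HasDerivAt (fun x => -β * (x - c) / α) (-β * 1 / α) x :=
      (((hasDerivAt_id x).sub_const c).const_mul (-β)).div_const α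
    exact hlin.exp.neg.congr_deriv (by ring)
  rw [← intervalIntegral.integral_const_mul,
    intervalIntegral.integral_eq_sub_of_hasDerivAt hderiv
      (Continuous.intervalIntegrable (by fun_prop) _ _)]
  ring

/-- the lowest-order (k = 0) local W-HDG balance equation on a 1d cell
determines the cell value `U` from the trace values and the weighted source alone. -/
theorem stmt7 (α h β τ Λ₀ Λ₁ : ℝ) (hα : 0 < α) (hh : 0 < h) (hτ : 0 < τ)
    (f : ℝ → ℝ) (hf : IntervalIntegrable f volume 0 h)
    (μ : ℝ → ℝ) (hμ : ∀ x, μ x = Real.exp (-β * (x - h / 2) / α))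
    (ep em F : ℝ)
    (hep : ep = Real.exp (β * h / (2 * α)))
    (hem : em = Real.exp (-(β * h) / (2 * α)))
    (hF : F = ∫ x in (0:ℝ)..h, f x * μ x) :
    ∀ J U : ℝ,
      ((β / α) * J * (∫ x in (0:ℝ)..h, μ x)
          + (J + τ * (U - Λ₁)) * μ h + (-J + τ * (U - Λ₀)) * μ 0 = F)
        ↔ U = (ep * Λ₀ + em * Λ₁) / (ep + em) + F / (τ * (ep + em)) := by
  intro J U
  have hμ0 : μ 0 = ep := by
    rw [hμ, hep]
    congr 1
    field_simp
    ring
  have hμh : μ h = em := by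
    rw [hμ, hem]
    congr 1
    field_simp
    ring
  have hint : (β / α) * (∫ x in (0:ℝ)..h, μ x) = ep - em := by
    rw [← hμ0, ← hμh, hμ 0, hμ h, ← integral_exp_weight]
    simp only [hμ]
  have hsum : 0 < ep + em := by
    rw [hep, hem]
    positivity
  have hbalance : (β / α) * J * (∫ x in (0:ℝ)..h, μ x)
      + (J + τ * (U - Λ₁)) * μ h + (-J + τ * (U - Λ₀)) * μ 0
      = U * (τ * (ep + em)) - τ * (ep * Λ₀ + em * Λ₁) := by
    rw [hμ0, hμh]
    linear_combination J * hint
  have hsol : (ep * Λ₀ + em * Λ₁) / (ep + em) + F / (τ * (ep + em))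
      = (τ * (ep * Λ₀ + em * Λ₁) + F) / (τ * (ep + em)) := by
    field_simp
  rw [hbalance, hsol, eq_div_iff (mul_pos hτ hsum).ne', sub_eq_iff_eq_add']
end

section
/- Let α > 0, β ∈ ℝ with β ≠ 0, h₁, h₂ > 0, Λ₋, Λ₀, Λ₊ ∈ ℝ, and F₁, F₂ ∈ ℝ. For m ∈ {1,2} set e_{m,±} = exp(±βh_m/(2α)). Define the Scharfetter–Gummel fluxes J₁ = (α/h₁)·( B(−βh₁/α)·Λ₋ − B(βh₁/α)·Λ₀ ) and J₂ = (α/h₂)·( B(−βh₂/α)·Λ₀ − B(βh₂/α)·Λ₊ ), where B is the Bernoulli function, and for τ > 0 define U₁(τ) = (e_{1,+}Λ₋ + e_{1,−}Λ₀)/(e_{1,+} + e_{1,−}) + F₁/(τ(e_{1,+} + e_{1,−})) and U₂(τ) = (e_{2,+}Λ₀ + e_{2,−}Λ₊)/(e_{2,+} + e_{2,−}) + F₂/(τ(e_{2,+} + e_{2,−})). Then, as τ → 0⁺, the W-HDG transmission residual J₁ − J₂ + τ·(U₁(τ) + U₂(τ) − 2Λ₀) converges to (α/h₁)·B(−βh₁/α)·Λ₋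 − ( (α/h₁)·B(βh₁/α) + (α/h₂)·B(−βh₂/α) )·Λ₀ + (α/h₂)·B(βh₂/α)·Λ₊ + F₁/(e_{1,+} + e_{1,−}) + F₂/(e_{2,+} + e_{2,−}). Hence in the vanishing-stabilization limit the piecewise-constant W-HDG transmission condition at an interior node reduces exactly to the three-point Scharfetter–Gummel finite volume scheme. -/
open MeasureTheory Filter

/-- in the vanishing-stabilization limit `τ → 0⁺`, the piecewise-constant
W-HDG transmission residual at an interior node converges to the three-point
Scharfetter–Gummel finite volume residual. -/
theorem stmt8 (α β h₁ h₂ Λm Λ₀ Λp F₁ F₂ : ℝ) (hα : 0 < α) (hβ : β ≠ 0)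
    (hh₁ : 0 < h₁) (hh₂ : 0 < h₂)
    (B : ℝ → ℝ) (hB : ∀ t, t ≠ 0 → B t = t / (Real.exp t - 1))
    (e1p e1m e2p e2m : ℝ)
    (he1p : e1p = Real.exp (β * h₁ / (2 * α)))
    (he1m : e1m = Real.exp (-(β * h₁) / (2 * α)))
    (he2p : e2p = Real.exp (β * h₂ / (2 * α)))
    (he2m : e2m = Real.exp (-(β * h₂) / (2 * α)))
    (J₁ J₂ : ℝ)
    (hJ₁ : J₁ = (α / h₁) * (B (-(β * h₁) / α) * Λm - B (β * h₁ / α) * Λ₀))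
    (hJ₂ : J₂ = (α / h₂) * (B (-(β * h₂) / α) * Λ₀ - B (β * h₂ / α) * Λp))
    (U₁ U₂ : ℝ → ℝ)
    (hU₁ : ∀ τ, U₁ τ = (e1p * Λm + e1m * Λ₀) / (e1p + e1m) + F₁ / (τ * (e1p + e1m)))
    (hU₂ : ∀ τ, U₂ τ = (e2p * Λ₀ + e2m * Λp) / (e2p + e2m) + F₂ / (τ * (e2p + e2m))) :
    Tendsto (fun τ : ℝ => J₁ - J₂ + τ * (U₁ τ + U₂ τ - 2 * Λ₀))
      (nhdsWithin 0 (Set.Ioi 0))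
      (nhds ((α / h₁) * B (-(β * h₁) / α) * Λm
        - ((α / h₁) * B (β * h₁ / α) + (α / h₂) * B (-(β * h₂) / α)) * Λ₀
        + (α / h₂) * B (β * h₂ / α) * Λp
        + F₁ / (e1p + e1m) + F₂ / (e2p + e2m))) := by
  have h1 : e1p + e1m ≠ 0 := by rw [he1p, he1m]; positivity
  have h2 : e2p + e2m ≠ 0 := by rw [he2p, he2m]; positivity
  set a := (e1p * Λm + e1m * Λ₀) / (e1p + e1m) + (e2p * Λ₀ + e2m * Λp) / (e2p + e2m) - 2 * Λ₀
    with ha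
  have hlim : Tendsto (fun τ : ℝ => J₁ - J₂ + F₁ / (e1p + e1m) + F₂ / (e2p + e2m) + τ * a)
      (nhdsWithin 0 (Set.Ioi 0))
      (nhds (J₁ - J₂ + F₁ / (e1p + e1m) + F₂ / (e2p + e2m) + 0 * a)) :=
    Continuous.continuousWithinAt (by fun_prop)
  have heq : (fun τ : ℝ => J₁ - J₂ + F₁ / (e1p + e1m) + F₂ / (e2p + e2m) + τ * a)
      =ᶠ[nhdsWithin 0 (Set.Ioi 0)] fun τ => J₁ - J₂ + τ * (U₁ τ + U₂ τ - 2 * Λ₀) := by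
    filter_upwards [self_mem_nhdsWithin] with τ hτ
    have hτ0 : τ ≠ 0 := ne_of_gt hτ
    rw [hU₁, hU₂, ha]
    field_simp
    ring
  convert hlim.congr' heq using 2
  rw [hJ₁, hJ₂]
  ring
end

section
/- Let α > 0, let x ∈ ℝ^d, and let ψ : ℝ^d → ℝ and u : ℝ^d → ℝ be differentiable at x. Set μ = exp(ψ/α). Then ⟨∇(μ·u)(x), ∇u(x)⟩ = ‖∇( exp(ψ/(2α))·u )(x)‖² − ( ‖∇ψ(x)‖² / (4α²) )·μ(x)·u(x)². -/
open Real RealInnerProductSpace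

/-- The gradient of `exp (ψ / β) * u` in a real Hilbert space. -/
theorem hasGradientAt_exp_div_mul {E : Type*} [NormedAddCommGroup E] [InnerProductSpace ℝ E]
    [CompleteSpace E] (β : ℝ) {x : E} {ψ u : E → ℝ}
    (hψ : DifferentiableAt ℝ ψ x) (hu : DifferentiableAt ℝ u x) :
    HasGradientAt (fun y => Real.exp (ψ y / β) * u y)
      (Real.exp (ψ x / β) • (gradient u x + (u x / β) • gradient ψ x)) x := by
  rw [hasGradientAt_iff_hasFDerivAt]
  have h := ((hψ.hasFDerivAt.mul_const β⁻¹).exp).mul hu.hasFDerivAt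
  simp only [← div_eq_mul_inv] at h
  refine h.congr_fderiv ?_
  ext v
  simp only [map_smul, map_add, toDual_gradient, add_apply,
    smul_apply, smul_eq_mul]
  ring

/-- the pointwise identity
`⟨∇(μu), ∇u⟩ = ‖∇(exp(ψ/(2α))·u)‖² − (‖∇ψ‖²/(4α²))·μ·u²` with `μ = exp(ψ/α)`. -/
theorem stmt9 {d : ℕ} (α : ℝ) (hα : 0 < α) (x : EuclideanSpace ℝ (Fin d))
    (ψ u : EuclideanSpace ℝ (Fin d) → ℝ)
    (hψ : DifferentiableAt ℝ ψ x) (hu : DifferentiableAt ℝ u x) :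
    ⟪gradient (fun y => Real.exp (ψ y / α) * u y) x, gradient u x⟫
      = ‖gradient (fun y => Real.exp (ψ y / (2 * α)) * u y) x‖ ^ 2
        - (‖gradient ψ x‖ ^ 2 / (4 * α ^ 2)) * Real.exp (ψ x / α) * (u x) ^ 2 := by
  have hα₀ : α ≠ 0 := hα.ne'
  have hexp : Real.exp (ψ x / (2 * α)) ^ 2 = Real.exp (ψ x / α) := by
    rw [← Real.exp_nat_mul]
    congr 1
    push_cast
    field_simp
  rw [(hasGradientAt_exp_div_mul α hψ hu).gradient,
    (hasGradientAt_exp_div_mul (2 * α) hψ hu).gradient, norm_smul, mul_pow, Real.norm_eq_abs,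
    sq_abs, hexp, norm_add_sq_real, norm_smul, mul_pow, Real.norm_eq_abs, sq_abs]
  simp only [real_inner_smul_left, real_inner_smul_right, inner_add_left,
    real_inner_self_eq_norm_sq, real_inner_comm (gradient ψ x)]
  field_simp
  ring
end

section
/- Let Ω ⊂ ℝ^d be open and bounded, let α > 0 and B ≥ 0, and let ψ : ℝ^d → ℝ be continuously differentiable with ‖∇ψ(x)‖ ≤ B for all x ∈ Ω; set μ = exp(ψ/α). Let C_p > 0 be a constant such that the Poincaré inequality ‖w‖_{L²(Ω)} ≤ C_p·‖∇w‖_{L²(Ω)} holds for every continuously differentiable w : ℝ^d → ℝ with compact support contained in Ω, and assume B·C_p/(2α) < 1. If u : ℝ^d → ℝ is continuously differentiable with compact support contained in Ω and ∫_Ω ⟨∇(μ·u)(x), ∇u(x)⟩ dx = 0, then u ≡ 0. -/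
open Real MeasureTheory RealInnerProductSpace

section Gradient

variable {E : Type*} [NormedAddCommGroup E] [InnerProductSpace ℝ E] [CompleteSpace E]

theorem ContDiff.continuous_gradient {f : E → ℝ} (hf : ContDiff ℝ 1 f) :
    Continuous (gradient f) :=
  (InnerProductSpace.toDual ℝ E).symm.continuous.comp (hf.continuous_fderiv one_ne_zero)

theorem HasCompactSupport.gradient {f : E → ℝ} (hf : HasCompactSupport f) :
    HasCompactSupport (gradient f) :=
  (hf.fderiv ℝ).comp_left (map_zero (InnerProductSpace.toDual ℝ E).symm)

theorem gradient_exp_div_mul {f u : E → ℝ} {x : E} (c : ℝ) (hf : DifferentiableAt ℝ f x)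
    (hu : DifferentiableAt ℝ u x) :
    gradient (fun y => Real.exp (f y / c) * u y) x =
      Real.exp (f x / c) • (gradient u x + (u x / c) • gradient f x) := by
  refine HasGradientAt.gradient (hasGradientAt_iff_hasFDerivAt.mpr ?_)
  refine (((hf.hasFDerivAt.mul_const c⁻¹).exp).mul hu.hasFDerivAt).congr_fderiv ?_
  ext v
  simp [div_eq_mul_inv]
  ring

theorem inner_gradient_exp_div_mul {f u : E → ℝ} {x : E} (c : ℝ) (hf : DifferentiableAt ℝ f x)
    (hu : DifferentiableAt ℝ u x) :
    ⟪gradient (fun y => Real.exp (f y / c) * u y) x, gradient u x⟫ =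
      ‖gradient (fun y => Real.exp (f y / (2 * c)) * u y) x‖ ^ 2 -
        (2 * c)⁻¹ ^ 2 * ((Real.exp (f x / (2 * c)) * u x) ^ 2 * ‖gradient f x‖ ^ 2) := by
  have he : Real.exp (f x / c) = Real.exp (f x / (2 * c)) ^ 2 := by
    rw [← Real.exp_nat_mul]
    congr 1
    push_cast
    rw [← mul_div_assoc, mul_div_mul_left _ _ two_ne_zero]
  rw [gradient_exp_div_mul c hf hu, gradient_exp_div_mul (2 * c) hf hu, he, norm_smul, mul_pow,
    norm_add_sq_real]
  simp only [inner_smul_left, inner_smul_right, inner_add_left, norm_smul, mul_pow,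
    real_inner_self_eq_norm_sq, Real.norm_eq_abs, sq_abs, conj_trivial,
    real_inner_comm (gradient u x) (gradient f x), div_eq_mul_inv, mul_inv]
  ring

end Gradient

/-- under the smallness condition `B·C_p/(2α) < 1` relating the drift bound
and the Poincaré constant, a compactly supported `C¹` function `u` with
`∫_Ω ⟨∇(μu), ∇u⟩ = 0` (where `μ = exp(ψ/α)`) vanishes identically. -/
theorem stmt10 {d : ℕ} (Ω : Set (EuclideanSpace ℝ (Fin d)))
    (hΩo : IsOpen Ω) (hΩb : Bornology.IsBounded Ω)
    (α B : ℝ) (hα : 0 < α) (hB : 0 ≤ B)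
    (ψ : EuclideanSpace ℝ (Fin d) → ℝ) (hψ : ContDiff ℝ 1 ψ)
    (hψB : ∀ x ∈ Ω, ‖gradient ψ x‖ ≤ B)
    (Cp : ℝ) (hCp : 0 < Cp)
    (hPoincare : ∀ w : EuclideanSpace ℝ (Fin d) → ℝ, ContDiff ℝ 1 w →
      HasCompactSupport w → tsupport w ⊆ Ω →
      Real.sqrt (∫ x in Ω, (w x) ^ 2) ≤ Cp * Real.sqrt (∫ x in Ω, ‖gradient w x‖ ^ 2))
    (hsmall : B * Cp / (2 * α) < 1)
    (u : EuclideanSpace ℝ (Fin d) → ℝ) (hu : ContDiff ℝ 1 u)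
    (hus : HasCompactSupport u) (husupp : tsupport u ⊆ Ω)
    (hzero : ∫ x in Ω,
      ⟪gradient (fun y => Real.exp (ψ y / α) * u y) x, gradient u x⟫ = 0) :
    ∀ x, u x = 0 := by
  set w : EuclideanSpace ℝ (Fin d) → ℝ := fun y => Real.exp (ψ y / (2 * α)) * u y with hw_def
  have hw : ContDiff ℝ 1 w := (hψ.div_const _).exp.mul hu
  have hws : HasCompactSupport w := hus.mul_left
  have hwsupp : tsupport w ⊆ Ω := (tsupport_mul_subset_right).trans husupp
  have hP := hPoincare w hw hws hwsupp
  have hw2c : Continuous fun x => w x ^ 2 := hw.continuous.pow 2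
  have hw2s : HasCompactSupport fun x => w x ^ 2 :=
    hws.comp_left (g := fun t : ℝ => t ^ 2) (by simp)
  have hg2c : Continuous fun x => ‖gradient w x‖ ^ 2 := hw.continuous_gradient.norm.pow 2
  have hg2s : HasCompactSupport fun x => ‖gradient w x‖ ^ 2 :=
    hws.gradient.comp_left (g := fun v => ‖v‖ ^ 2) (by simp)
  have hψ2c : Continuous fun x => ‖gradient ψ x‖ ^ 2 := hψ.continuous_gradient.norm.pow 2
  have hwint : IntegrableOn (fun x => w x ^ 2) Ω :=
    (hw2c.integrable_of_hasCompactSupport hw2s).integrableOn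
  have hgint : IntegrableOn (fun x => ‖gradient w x‖ ^ 2) Ω :=
    (hg2c.integrable_of_hasCompactSupport hg2s).integrableOn
  have hwψint : IntegrableOn (fun x => w x ^ 2 * ‖gradient ψ x‖ ^ 2) Ω :=
    ((hw2c.mul hψ2c).integrable_of_hasCompactSupport hw2s.mul_right).integrableOn
  have henergy : ∫ x in Ω, ‖gradient w x‖ ^ 2 =
      (2 * α)⁻¹ ^ 2 * ∫ x in Ω, w x ^ 2 * ‖gradient ψ x‖ ^ 2 := by
    rw [← sub_eq_zero, ← hzero, ← integral_const_mul,
      ← integral_sub hgint (hwψint.const_mul _)]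
    exact integral_congr_ae (.of_forall fun x => (inner_gradient_exp_div_mul α
      (hψ.differentiable one_ne_zero x) (hu.differentiable one_ne_zero x)).symm)
  have hdrift : ∫ x in Ω, w x ^ 2 * ‖gradient ψ x‖ ^ 2 ≤ B ^ 2 * ∫ x in Ω, w x ^ 2 := by
    have hle : ∀ x ∈ Ω, w x ^ 2 * ‖gradient ψ x‖ ^ 2 ≤ B ^ 2 * w x ^ 2 := fun x hx => by
      rw [mul_comm]
      gcongr
      exact hψB x hx
    have hint : IntegrableOn (fun x => B ^ 2 * w x ^ 2) Ω := hwint.const_mul _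
    rw [← integral_const_mul]
    exact setIntegral_mono_on hwψint hint hΩo.measurableSet hle
  have hG : 0 ≤ ∫ x in Ω, ‖gradient w x‖ ^ 2 := integral_nonneg fun x => by positivity
  have hW : 0 ≤ ∫ x in Ω, w x ^ 2 := integral_nonneg fun x => by positivity
  have hP2 : ∫ x in Ω, w x ^ 2 ≤ Cp ^ 2 * ∫ x in Ω, ‖gradient w x‖ ^ 2 := by
    have := pow_le_pow_left₀ (Real.sqrt_nonneg _) hP 2
    rwa [mul_pow, Real.sq_sqrt hG, Real.sq_sqrt hW] at this
  have hk : (B * Cp / (2 * α)) ^ 2 < 1 := pow_lt_one₀ (by positivity) hsmall two_ne_zero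
  have hG0 : ∫ x in Ω, ‖gradient w x‖ ^ 2 = 0 := by
    have h : ∫ x in Ω, ‖gradient w x‖ ^ 2 ≤
        (B * Cp / (2 * α)) ^ 2 * ∫ x in Ω, ‖gradient w x‖ ^ 2 := calc
      _ = (2 * α)⁻¹ ^ 2 * ∫ x in Ω, w x ^ 2 * ‖gradient ψ x‖ ^ 2 := henergy
      _ ≤ (2 * α)⁻¹ ^ 2 * (B ^ 2 * (Cp ^ 2 * ∫ x in Ω, ‖gradient w x‖ ^ 2)) := by
        gcongr
        exact hdrift.trans (by gcongr)
      _ = _ := by ring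
    nlinarith
  have hW0 : ∫ x in Ω, w x ^ 2 = 0 := by
    rw [hG0, mul_zero] at hP2
    exact hP2.antisymm hW
  have hwΩ : Set.EqOn (fun x => w x ^ 2) 0 Ω :=
    Measure.eqOn_open_of_ae_eq ((integral_eq_zero_iff_of_nonneg (fun x => sq_nonneg _) hwint).mp hW0)
      hΩo (hw.continuous.pow 2).continuousOn continuousOn_const
  intro x
  by_cases hx : x ∈ Ω
  · simpa [hw_def, (Real.exp_pos _).ne'] using hwΩ hx
  · exact image_eq_zero_of_notMem_tsupport fun h => hx (husupp h)
end

section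
/- Let α > 0, N ≥ 1, k ≥ 0, and let a = x₀ < x₁ < ⋯ < x_N = b. Let β₁,…,β_N ∈ ℝ and c₁,…,c_N ∈ ℝ, define μ_i(x) = exp(−β_i·(x − c_i)/α) on [x_{i−1}, x_i] for each i, and assume the resulting piecewise weight is globally continuous, i.e. μ_i(x_i) = μ_{i+1}(x_i) for i = 1,…,N−1. Let τ_i^L > 0 and τ_i^R > 0 for i = 1,…,N. Suppose Λ₀, Λ₁, …, Λ_N ∈ ℝ with Λ₀ = Λ_N = 0, and for each i = 1,…,N suppose J_i and U_i are real polynomials of degree at most k such that: (i) for every polynomial Q of degree at most k, ∫_{x_{i−1}}^{x_i} μ_i J_i Q dx − α·∫_{x_{i−1}}^{x_i} μ_i U_i Q′ dx + α·( Λ_i·μ_i(x_i)·Q(x_i) − Λ_{i−1}·μ_i(x_{i−1})·Q(x_{i−1}) ) = 0; (ii) for every polynomial W of degree at most k, −∫_{x_{i−1}}^{x_i} μ_i J_i (W′ − (β_i/α)W) dx + ( J_i(x_i) + τ_i^R·(U_i(x_i) − Λ_i) )·μ_i(x_i)·W(x_i) + ( −J_i(x_{i−1}) + τ_i^L·(U_i(x_{i−1})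 − Λ_{i−1}) )·μ_i(x_{i−1})·W(x_{i−1}) = 0; and (iii) for every interior node i = 1,…,N−1, J_i(x_i) − J_{i+1}(x_i) + τ_i^R·(U_i(x_i) − Λ_i) + τ_{i+1}^L·(U_{i+1}(x_i) − Λ_i) = 0. Then Λ_i = 0 for all i = 0,…,N, and J_i = 0 and U_i = 0 for all i = 1,…,N. -/
open MeasureTheory Polynomial

theorem hasDerivAt_exp_weight (α β c y : ℝ) :
    HasDerivAt (fun y => Real.exp (-β * (y - c) / α))
      (-(β / α) * Real.exp (-β * (y - c) / α)) y := by
  refine ((((hasDerivAt_id' y).sub_const c).const_mul (-β)).div_const α).exp.congr_deriv ?_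
  ring

theorem continuous_exp_weight (α β c : ℝ) :
    Continuous (fun y => Real.exp (-β * (y - c) / α)) := by
  fun_prop

/-- The fundamental theorem of calculus for an exponentially weighted polynomial. -/
theorem integral_exp_weight_mul_polynomial (α β c a b : ℝ) (w : ℝ → ℝ)
    (hw : ∀ y, w y = Real.exp (-β * (y - c) / α)) (P : ℝ[X]) :
    ∫ y in a..b, w y * ((derivative P).eval y - β / α * P.eval y) =
      w b * P.eval b - w a * P.eval a := by
  obtain rfl : w = fun y => Real.exp (-β * (y - c) / α) := funext hw
  refine intervalIntegral.integral_eq_sub_of_hasDerivAt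
    (f := fun y => Real.exp (-β * (y - c) / α) * P.eval y) (fun y _ => ?_) ?_
  · refine ((hasDerivAt_exp_weight α β c y).mul (P.hasDerivAt y)).congr_deriv ?_
    ring
  · apply Continuous.intervalIntegrable
    fun_prop

theorem Polynomial.eq_zero_of_integral_weight_mul_sq_eq_zero {a b : ℝ} (hab : a < b)
    {w : ℝ → ℝ} (hw : Continuous w) (hpos : ∀ y, 0 < w y) {P : ℝ[X]}
    (h : ∫ y in a..b, w y * P.eval y * P.eval y = 0) : P = 0 := by
  by_contra hP
  have key : ∃ z ∈ Set.Icc a b, P.eval z ≠ 0 := by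
    by_contra! hz
    exact hP (P.eq_zero_of_infinite_isRoot ((Set.Icc_infinite hab).mono hz))
  obtain ⟨z, hz, hPz⟩ := key
  refine (intervalIntegral.integral_pos hab (f := fun y => w y * P.eval y * P.eval y)
    (by fun_prop) (fun y _ => ?_) ⟨z, hz, ?_⟩).ne' h
  · have := hpos y
    rw [mul_assoc]
    exact mul_nonneg this.le (mul_self_nonneg _)
  · rw [mul_assoc]
    exact mul_pos (hpos z) (mul_self_pos.2 hPz)

theorem Polynomial.natDegree_eq_zero_of_derivative_eq_C_mul {r : ℝ} {P : ℝ[X]}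
    (h : derivative P = C r * P) : P.natDegree = 0 := by
  by_contra hd
  rcases eq_or_ne r 0 with rfl | hr
  · exact hd (derivative_eq_zero.1 (by simpa using h))
  · have := natDegree_derivative_lt hd
    rw [h, natDegree_C_mul hr] at this
    exact this.false

/-- Energy identity of the homogeneous local W-HDG problem on the cell `[a, b]`. -/
theorem local_energy_identity {α β c a b : ℝ} (w : ℝ → ℝ)
    (hw : ∀ y, w y = Real.exp (-β * (y - c) / α)) {tL tR lL lR : ℝ} {J U : ℝ[X]}
    (h1 : (∫ y in a..b, w y * J.eval y * J.eval y)
        - α * (∫ y in a..b, w y * U.eval y * (derivative J).eval y)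
        + α * (lR * w b * J.eval b - lL * w a * J.eval a) = 0)
    (h2 : -(∫ y in a..b, w y * J.eval y * ((derivative U).eval y - (β / α) * U.eval y))
        + (J.eval b + tR * (U.eval b - lR)) * w b * U.eval b
        + (-J.eval a + tL * (U.eval a - lL)) * w a * U.eval a = 0) :
    (∫ y in a..b, w y * J.eval y * J.eval y)
      + α * (tR * (U.eval b - lR) ^ 2 * w b + tL * (U.eval a - lL) ^ 2 * w a)
      = α * (lL * w a * (J.eval a - tL * (U.eval a - lL)))
        - α * (lR * w b * (J.eval b + tR * (U.eval b - lR))) := by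
  have hwc : Continuous w := by
    rw [funext hw]
    exact continuous_exp_weight α β c
  have hsum : (∫ y in a..b, w y * J.eval y * ((derivative U).eval y - (β / α) * U.eval y))
      + (∫ y in a..b, w y * U.eval y * (derivative J).eval y)
      = w b * (J * U).eval b - w a * (J * U).eval a := by
    rw [← integral_exp_weight_mul_polynomial α β c a b w hw (J * U),
      ← intervalIntegral.integral_add]
    · refine intervalIntegral.integral_congr fun y _ => ?_
      simp only [derivative_mul, eval_add, eval_mul]
      ring
    · exact Continuous.intervalIntegrable (by fun_prop) _ _
    · exact Continuous.intervalIntegrable (by fun_prop) _ _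
  simp only [eval_mul] at hsum
  linear_combination h1 + α * h2 + α * hsum

/-- A density with vanishing flux that matches its traces at both endpoints is constant. -/
theorem natDegree_density_eq_zero {α β c a b : ℝ} (hα : α ≠ 0) (hab : a < b) (w : ℝ → ℝ)
    (hw : ∀ y, w y = Real.exp (-β * (y - c) / α)) {k : ℕ} {U : ℝ[X]} (hU : U.degree ≤ k)
    (h : ∀ Q : ℝ[X], Q.degree ≤ k →
      -(α * (∫ y in a..b, w y * U.eval y * (derivative Q).eval y))
        + α * (U.eval b * w b * Q.eval b - U.eval a * w a * Q.eval a) = 0) :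
    U.natDegree = 0 := by
  have hwc : Continuous w := by
    rw [funext hw]
    exact continuous_exp_weight α β c
  set Q : ℝ[X] := derivative U - C (β / α) * U with hQ
  have hQdeg : Q.degree ≤ k :=
    (degree_sub_le _ _).trans
      (max_le (degree_derivative_le.trans hU) ((smul_eq_C_mul (β / α) ▸ degree_smul_le _ U).trans hU))
  have hint : (∫ y in a..b, w y * Q.eval y * Q.eval y)
      + (∫ y in a..b, w y * U.eval y * (derivative Q).eval y)
      = w b * (U * Q).eval b - w a * (U * Q).eval a := by
    rw [← integral_exp_weight_mul_polynomial α β c a b w hw (U * Q),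
      ← intervalIntegral.integral_add]
    · refine intervalIntegral.integral_congr fun y _ => ?_
      have hQy : Q.eval y = (derivative U).eval y - β / α * U.eval y := by simp [hQ]
      simp only [derivative_mul, eval_add, eval_mul]
      linear_combination (w y * Q.eval y) * hQy
    · exact Continuous.intervalIntegrable (by fun_prop) _ _
    · exact Continuous.intervalIntegrable (by fun_prop) _ _
  simp only [eval_mul] at hint
  have hzero : ∫ y in a..b, w y * Q.eval y * Q.eval y = 0 := by
    apply mul_left_cancel₀ hα
    linear_combination α * hint + h Q hQdeg
  have hQ0 := eq_zero_of_integral_weight_mul_sq_eq_zero hab hwc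
    (fun y => hw y ▸ Real.exp_pos _) hzero
  exact natDegree_eq_zero_of_derivative_eq_C_mul (sub_eq_zero.1 (hQ ▸ hQ0))

/-- one-dimensional homogeneous-data unique solvability of the global W-HDG
system: with a globally continuous piecewise exponential weight, strictly positive
stabilization on both endpoints of every cell, zero Dirichlet data and zero source, the
local equations (i)–(ii) and the transmission condition (iii) force all skeleton values,
fluxes and densities to vanish. -/
theorem stmt15 (α : ℝ) (hα : 0 < α) (N k : ℕ) (hN : 1 ≤ N)
    (x : ℕ → ℝ) (hx : ∀ i < N, x i < x (i + 1))
    (β c : ℕ → ℝ)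
    (μ : ℕ → ℝ → ℝ)
    (hμ : ∀ i y, μ i y = Real.exp (-(β i) * (y - c i) / α))
    (hμcont : ∀ i, 1 ≤ i → i ≤ N - 1 → μ i (x i) = μ (i + 1) (x i))
    (τL τR : ℕ → ℝ)
    (hτL : ∀ i, 1 ≤ i → i ≤ N → 0 < τL i)
    (hτR : ∀ i, 1 ≤ i → i ≤ N → 0 < τR i)
    (Λ : ℕ → ℝ) (hΛ0 : Λ 0 = 0) (hΛN : Λ N = 0)
    (J U : ℕ → Polynomial ℝ)
    (hJdeg : ∀ i, 1 ≤ i → i ≤ N → (J i).degree ≤ k)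
    (hUdeg : ∀ i, 1 ≤ i → i ≤ N → (U i).degree ≤ k)
    (heq1 : ∀ i, 1 ≤ i → i ≤ N → ∀ Q : Polynomial ℝ, Q.degree ≤ k →
      (∫ y in (x (i - 1))..(x i), μ i y * (J i).eval y * Q.eval y)
        - α * (∫ y in (x (i - 1))..(x i), μ i y * (U i).eval y * (derivative Q).eval y)
        + α * (Λ i * μ i (x i) * Q.eval (x i)
            - Λ (i - 1) * μ i (x (i - 1)) * Q.eval (x (i - 1))) = 0)
    (heq2 : ∀ i, 1 ≤ i → i ≤ N → ∀ W : Polynomial ℝ, W.degree ≤ k →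
      -(∫ y in (x (i - 1))..(x i), μ i y * (J i).eval y *
          ((derivative W).eval y - (β i / α) * W.eval y))
        + ((J i).eval (x i) + τR i * ((U i).eval (x i) - Λ i))
            * μ i (x i) * W.eval (x i)
        + (-(J i).eval (x (i - 1)) + τL i * ((U i).eval (x (i - 1)) - Λ (i - 1)))
            * μ i (x (i - 1)) * W.eval (x (i - 1)) = 0)
    (heq3 : ∀ i, 1 ≤ i → i ≤ N - 1 →
      (J i).eval (x i) - (J (i + 1)).eval (x i)
        + τR i * ((U i).eval (x i) - Λ i)
        + τL (i + 1) * ((U (i + 1)).eval (x i) - Λ i) = 0) :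
    (∀ i ≤ N, Λ i = 0) ∧ (∀ i, 1 ≤ i → i ≤ N → J i = 0 ∧ U i = 0) := by
  have hxi : ∀ i, 1 ≤ i → i ≤ N → x (i - 1) < x i := fun i h1 hi => by
    simpa [Nat.sub_add_cancel h1] using hx (i - 1) (by omega)
  have hpos : ∀ i y, 0 < μ i y := fun i y => hμ i y ▸ Real.exp_pos _
  have hcont : ∀ i, Continuous (μ i) := fun i => by
    rw [funext (hμ i)]
    exact continuous_exp_weight α (β i) (c i)
  set S : ℕ → ℝ := fun i => ∫ y in (x (i - 1))..(x i), μ i y * (J i).eval y * (J i).eval y with hS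
  have hSnonneg : ∀ i, 1 ≤ i → i ≤ N → 0 ≤ S i := fun i h1 hi =>
    intervalIntegral.integral_nonneg (hxi i h1 hi).le fun y _ => by
      rw [mul_assoc]
      exact mul_nonneg (hpos i y).le (mul_self_nonneg _)
  set R : ℕ → ℝ := fun i => τR i * ((U i).eval (x i) - Λ i) ^ 2 * μ i (x i) with hR
  set L : ℕ → ℝ := fun i =>
    τL i * ((U i).eval (x (i - 1)) - Λ (i - 1)) ^ 2 * μ i (x (i - 1)) with hL
  have hRnonneg : ∀ i, 1 ≤ i → i ≤ N → 0 ≤ R i := fun i h1 hi =>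
    mul_nonneg (mul_nonneg (hτR i h1 hi).le (sq_nonneg _)) (hpos i _).le
  have hLnonneg : ∀ i, 1 ≤ i → i ≤ N → 0 ≤ L i := fun i h1 hi =>
    mul_nonneg (mul_nonneg (hτL i h1 hi).le (sq_nonneg _)) (hpos i _).le
  set H : ℕ → ℝ := fun i =>
    α * (Λ i * μ i (x i) * ((J i).eval (x i) + τR i * ((U i).eval (x i) - Λ i))) with hH
  have henergy : ∀ i < N,
      S (i + 1) + α * (R (i + 1) + L (i + 1)) = H i - H (i + 1) := fun i hi => by
    have h1 : 1 ≤ i + 1 := by omega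
    have hE := local_energy_identity (μ (i + 1)) (hμ (i + 1))
      (heq1 (i + 1) h1 hi (J (i + 1)) (hJdeg (i + 1) h1 hi))
      (heq2 (i + 1) h1 hi (U (i + 1)) (hUdeg (i + 1) h1 hi))
    refine hE.trans ?_
    simp only [hH, Nat.add_sub_cancel]
    rcases Nat.eq_zero_or_pos i with rfl | hi0
    · simp [hΛ0]
    · rw [hμcont i hi0 (by omega)]
      linear_combination (-(α * Λ i * μ (i + 1) (x i))) * heq3 i hi0 (by omega)
  have hterm : ∀ i < N, 0 ≤ S (i + 1) + α * (R (i + 1) + L (i + 1)) := fun i hi =>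
    add_nonneg (hSnonneg _ (by omega) hi)
      (mul_nonneg hα.le (add_nonneg (hRnonneg _ (by omega) hi) (hLnonneg _ (by omega) hi)))
  have htotal : ∑ i ∈ Finset.range N, (S (i + 1) + α * (R (i + 1) + L (i + 1))) = 0 := by
    rw [Finset.sum_congr rfl fun i hi => henergy i (Finset.mem_range.1 hi),
      Finset.sum_range_sub']
    simp [hH, hΛ0, hΛN]
  have hvanish := (Finset.sum_eq_zero_iff_of_nonneg
    fun i hi => hterm i (Finset.mem_range.1 hi)).1 htotal
  have hcell : ∀ i < N, J (i + 1) = 0 ∧ (U (i + 1)).eval (x (i + 1)) = Λ (i + 1) ∧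
      (U (i + 1)).eval (x i) = Λ i := fun i hi => by
    have h1 : 1 ≤ i + 1 := by omega
    have h0 := hvanish i (Finset.mem_range.2 hi)
    have hS0 := hSnonneg (i + 1) h1 hi
    have hR0 := hRnonneg (i + 1) h1 hi
    have hL0 := hLnonneg (i + 1) h1 hi
    have hRL := (add_eq_zero_iff_of_nonneg hS0 (mul_nonneg hα.le (add_nonneg hR0 hL0))).1 h0
    have hRL' := (add_eq_zero_iff_of_nonneg hR0 hL0).1
      ((mul_eq_zero.1 hRL.2).resolve_left hα.ne')
    refine ⟨eq_zero_of_integral_weight_mul_sq_eq_zero (hxi _ h1 hi) (hcont _) (hpos _) hRL.1,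
      ?_, ?_⟩
    · simpa [hR, (hτR _ h1 hi).ne', (hpos (i + 1) _).ne', sub_eq_zero] using hRL'.1
    · simpa [hL, (hτL _ h1 hi).ne', (hpos (i + 1) _).ne', sub_eq_zero] using hRL'.2
  have hconst : ∀ i < N, (U (i + 1)).natDegree = 0 := fun i hi => by
    have h1 : 1 ≤ i + 1 := by omega
    obtain ⟨hJ, hUR, hUL⟩ := hcell i hi
    refine natDegree_density_eq_zero hα.ne' (hx i hi) (μ (i + 1)) (hμ (i + 1))
      (hUdeg (i + 1) h1 hi) fun Q hQ => ?_
    have := heq1 (i + 1) h1 hi Q hQ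
    rw [hUR, hUL]
    simpa [hJ] using this
  have hU : ∀ i < N, Λ i = 0 → U (i + 1) = 0 := fun i hi hΛi => by
    have hC := eq_C_of_natDegree_eq_zero (hconst i hi)
    have hUL := (hcell i hi).2.2
    rw [hC, eval_C, hΛi] at hUL
    rw [hC, hUL, C_0]
  have hΛ : ∀ i ≤ N, Λ i = 0 := by
    intro i
    induction i with
    | zero => exact fun _ => hΛ0
    | succ i ih =>
      intro hi
      rw [← (hcell i hi).2.1, hU i hi (ih (by omega)), eval_zero]
  refine ⟨hΛ, fun i h1 hi => ?_⟩
  obtain ⟨j, rfl⟩ : ∃ j, i = j + 1 := ⟨i - 1, by omega⟩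
  exact ⟨(hcell j hi).1, hU j hi (hΛ j (by omega))⟩
end
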